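/- Let K/ℚ be a finite Galois extension with group G. Then log|Δ_K| = Σ_{χ ∈ Irr(G)} χ(1) · log f(K/ℚ, χ), where Δ_K is the absolute discriminant and f(K/ℚ,χ) is the (norm of the) Artin conductor of χ. -/

import Mathlib

open CategoryTheory NumberField

/-- The subspace of a representation invariant under a subgroup. -/
noncomputable def FDRep.subInvariants {G : Type} [Group G] (W : FDRep ℂ G) (H : Subgroup G) :
    Submodule ℂ W :=
  Representation.invariants (k := ℂ) (G := H) (V := W) (W.ρ.comp H.subtype)

namespace Representation

open scoped MonoidAlgebra

variable {k G : Type*} [Field k] [Group G]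

/-- The module attached to the representation attached to a module is the module itself. -/
noncomputable def ofModule'AsModuleEquiv (M : Type*) [AddCommGroup M] [Module k M] [Module k[G] M]
    [IsScalarTower k k[G] M] : (ofModule' (k := k) (G := G) M).asModule ≃ₗ[k[G]] M where
  __ := (ofModule' (k := k) (G := G) M).asModuleEquiv
  map_smul' r x := by
    induction r using MonoidAlgebra.induction_linear with
    | zero => simp
    | add a b ha hb =>
      simp only [add_smul, map_add, AddHom.toFun_eq_coe, LinearMap.coe_toAddHom,
        LinearEquiv.coe_coe, RingHom.id_apply] at ha hb ⊢
      rw [ha, hb]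
    | single g a =>
      have : (MonoidAlgebra.single g a : k[G]) = a • MonoidAlgebra.single g 1 := by simp
      simp only [single_smul, AddHom.toFun_eq_coe, LinearMap.coe_toAddHom,
        LinearEquiv.coe_coe, RingHom.id_apply, this, smul_assoc, one_smul]
      rfl

/-- Intertwining maps from a representation given by a module are linear maps over the group
algebra. -/
noncomputable def ofModule'IntertwiningEquiv (M : Type*) [AddCommGroup M] [Module k M]
    [Module k[G] M] [IsScalarTower k k[G] M] {V : Type*} [AddCommGroup V] [Module k V]
    (σ : Representation k G V) :
    IntertwiningMap (ofModule' (k := k) (G := G) M) σ ≃ₗ[k] (M →ₗ[k[G]] σ.asModule) :=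
  IntertwiningMap.equivLinearMapAsModule _ _ ≪≫ₗ
    LinearEquiv.congrLeft σ.asModule k (ofModule'AsModuleEquiv (k := k) (G := G) M)

theorem isIrreducible_ofModule' (M : Type*) [AddCommGroup M] [Module k M] [Module k[G] M]
    [IsScalarTower k k[G] M] [IsSimpleModule k[G] M] :
    IsIrreducible (ofModule' (k := k) (G := G) M) :=
  (irreducible_iff_isSimpleModule_asModule _).mpr (.congr (ofModule'AsModuleEquiv M))

/-- The function on `G ⧸ H` given by acting on an `H`-invariant vector. -/
def orbitQuotientMap {V : Type*} [AddCommGroup V] [Module k V] (σ : Representation k G V)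
    (H : Subgroup G) (v : invariants (σ.comp H.subtype : Representation k H V)) (q : G ⧸ H) : V :=
  Quotient.liftOn' q (fun g ↦ σ g v) fun a b hab ↦ by
    have h : σ (a⁻¹ * b) v = v := v.2 ⟨_, QuotientGroup.leftRel_apply.mp hab⟩
    conv_lhs => rw [← h, ← Module.End.mul_apply, ← map_mul, mul_inv_cancel_left]

/-- Frobenius reciprocity for the permutation representation on `G ⧸ H`. -/
noncomputable def ofMulActionQuotientIntertwiningEquiv {V : Type*} [AddCommGroup V] [Module k V]
    (σ : Representation k G V) (H : Subgroup G) :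
    IntertwiningMap (ofMulAction k G (G ⧸ H)) σ ≃ₗ[k]
      invariants (σ.comp H.subtype : Representation k H V) where
  toFun f := ⟨f (MonoidAlgebra.single ((1 : G) : G ⧸ H) 1), fun h ↦ by
    have h1 : (h : G) • ((1 : G) : G ⧸ H) = ((1 : G) : G ⧸ H) := by
      rw [MulAction.Quotient.smul_coe, QuotientGroup.eq]
      simp
    simp only [MonoidHom.coe_comp, Function.comp_apply, Subgroup.coe_subtype]
    rw [← f.isIntertwining, ofMulAction_single, h1]⟩
  map_add' _ _ := rfl
  map_smul' _ _ := rfl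
  invFun v := ⟨Finsupp.llift _ _ k _ (orbitQuotientMap σ H v) ∘ₗ
    (MonoidAlgebra.coeffLinearEquiv _).toLinearMap, fun g ↦ by
      ext q
      induction q using QuotientGroup.induction_on with
      | H a => simp [orbitQuotientMap]⟩
  left_inv f := by
    ext q
    induction q using QuotientGroup.induction_on with
    | H a => simp [orbitQuotientMap, ← f.isIntertwining]
  right_inv v := by
    ext
    simp [orbitQuotientMap]

end Representation

namespace FDRep

open scoped MonoidAlgebra

open Representation Module

variable {k G : Type} [Field k] [Group G]

/-- Morphisms in `FDRep` are intertwining maps. -/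
noncomputable def homEquivIntertwiningMap (X Y : FDRep k G) :
    (X ⟶ Y) ≃ₗ[k] IntertwiningMap X.ρ Y.ρ :=
  (FDRep.forget₂HomLinearEquiv _ _).symm ≪≫ₗ Rep.homLinearEquiv _ _

/-- Morphisms in `FDRep` from a representation given by a module are linear maps over the group
algebra. -/
noncomputable def homOfModule'Equiv (M : Type) [AddCommGroup M] [Module k M] [Module k[G] M]
    [IsScalarTower k k[G] M] [Module.Finite k M] (W : FDRep k G) :
    (FDRep.of (ofModule' (k := k) (G := G) M) ⟶ W) ≃ₗ[k] (M →ₗ[k[G]] asModule W.ρ) :=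
  homEquivIntertwiningMap _ _ ≪≫ₗ ofModule'IntertwiningEquiv M W.ρ

theorem simple_of_ofModule' [Finite G] [IsAlgClosed k] [NeZero (Nat.card G : k)]
    (M : Type) [AddCommGroup M] [Module k M] [Module k[G] M]
    [IsScalarTower k k[G] M] [Module.Finite k M] [IsSimpleModule k[G] M] :
    Simple (FDRep.of (ofModule' (k := k) (G := G) M)) := by
  have := isIrreducible_ofModule' (k := k) (G := G) M
  rw [simple_iff_end_is_rank_one, (homEquivIntertwiningMap _ _).finrank_eq]
  exact IsIrreducible.finrank_intertwiningMap_self (ofModule' (k := k) (G := G) M)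

variable {ι : Type} [Fintype ι] {V : ι → FDRep k G}

theorem sum_finrank_mul_finrank_linearMap [Finite G] [IsAlgClosed k] [NeZero (Nat.card G : k)]
    (hirr : ∀ j, Simple (V j))
    (hinj : ∀ j j' : ι, Nonempty (V j ≅ V j') → j = j')
    (hcomplete : ∀ W : FDRep k G, Simple W → ∃ j, Nonempty (W ≅ V j))
    (M : Type) [AddCommGroup M] [Module k M] [Module k[G] M]
    [IsScalarTower k k[G] M] [Module.Finite k M] :
    ∑ j, finrank k (V j) * finrank k (M →ₗ[k[G]] asModule (V j).ρ) = finrank k M := by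
  classical
  have : Module.Finite k[G] M := Module.Finite.of_restrictScalars_finite k k[G] M
  obtain ⟨n, S, e, hS⟩ := IsSemisimpleModule.exists_linearEquiv_fin_dfinsupp k[G] M
  have hfin (i : Fin n) : Module.Finite k (S i) :=
    inferInstanceAs (Module.Finite k ((S i).restrictScalars k))
  have hsimple (i : Fin n) : Simple (FDRep.of (ofModule' (k := k) (G := G) (S i))) :=
    simple_of_ofModule' (S i)
  choose c hc using fun i ↦ hcomplete _ (hsimple i)
  have hM : finrank k M = ∑ i, finrank k (V (c i)) := by
    rw [((e.trans DFinsupp.linearEquivFunOnFintype).restrictScalars k).finrank_eq,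
      finrank_pi_fintype]
    exact Finset.sum_congr rfl fun i _ ↦ (isoToLinearEquiv (hc i).some).finrank_eq
  have hhom (j : ι) : finrank k (M →ₗ[k[G]] asModule (V j).ρ) =
      ∑ i, if c i = j then 1 else 0 := by
    rw [(LinearEquiv.congrLeft (asModule (V j).ρ) k
        (e.trans DFinsupp.linearEquivFunOnFintype)).finrank_eq,
      ← (LinearMap.lsum k[G] (fun i ↦ S i) k).finrank_eq]
    have (i : Fin n) : Module.Finite k (S i →ₗ[k[G]] asModule (V j).ρ) :=
      .equiv (homOfModule'Equiv (S i) (V j))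
    rw [finrank_pi_fintype]
    refine Finset.sum_congr rfl fun i _ ↦ ?_
    rw [← (homOfModule'Equiv (S i) (V j)).finrank_eq]
    have := hsimple i
    have := hirr j
    rw [finrank_hom_simple_simple]
    refine if_congr ⟨fun ⟨f⟩ ↦ hinj _ _ ⟨(hc i).some.symm ≪≫ f⟩, ?_⟩ rfl rfl
    rintro rfl
    exact hc i
  simp_rw [hM, hhom, Finset.mul_sum]
  rw [Finset.sum_comm]
  simp

/-- The multiplicities of the irreducible representations in the permutation representation on
`G ⧸ H` add up to its dimension. -/
theorem sum_finrank_mul_finrank_subInvariants {G : Type} [Group G] [Finite G] {V : ι → FDRep ℂ G}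
    (hirr : ∀ j, Simple (V j))
    (hinj : ∀ j j' : ι, Nonempty (V j ≅ V j') → j = j')
    (hcomplete : ∀ W : FDRep ℂ G, Simple W → ∃ j, Nonempty (W ≅ V j)) (H : Subgroup G) :
    ∑ j, finrank ℂ (V j) * finrank ℂ ((V j).subInvariants H) = H.index := by
  have : Fintype (G ⧸ H) := Fintype.ofFinite _
  have : Module.Finite ℂ (ofMulAction ℂ G (G ⧸ H)).asModule :=
    .equiv (MonoidAlgebra.coeffLinearEquiv ℂ).symm
  have key := sum_finrank_mul_finrank_linearMap hirr hinj hcomplete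
    (ofMulAction ℂ G (G ⧸ H)).asModule
  have h1 : finrank ℂ (ofMulAction ℂ G (G ⧸ H)).asModule = H.index := by
    rw [((ofMulAction ℂ G (G ⧸ H)).asModuleEquiv.trans
      (MonoidAlgebra.coeffLinearEquiv ℂ)).finrank_eq, finrank_finsupp_self,
      Subgroup.index_eq_card, Nat.card_eq_fintype_card]
  rw [← h1, ← key]
  refine Finset.sum_congr rfl fun j _ ↦ congrArg _ ?_
  rw [← (IntertwiningMap.equivLinearMapAsModule _ _).finrank_eq]
  exact (ofMulActionQuotientIntertwiningEquiv (V j).ρ H).finrank_eq.symm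

end FDRep

theorem Ideal.exists_mem_pow_card_sub_self_notMem_sq {O : Type*} [CommRing O] [IsDedekindDomain O]
    {Q : Ideal O} [hQ : Q.IsMaximal] (hQ0 : Q ≠ ⊥) [Finite (O ⧸ Q)] {B : Ideal O}
    (hB : Q ⊔ B = ⊤) :
    ∃ α ∈ B, α ∉ Q ∧ (∀ x ∉ Q, ∃ n : ℕ, x - α ^ n ∈ Q) ∧
      α ^ Nat.card (O ⧸ Q) - α ∉ Q ^ 2 := by
  classical
  let _ : Field (O ⧸ Q) := Ideal.Quotient.field Q
  let _ : Fintype (O ⧸ Q) := Fintype.ofFinite _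
  set q := Nat.card (O ⧸ Q) with hq
  have hqQ : (q : O) ∈ Q := by
    rw [← Ideal.Quotient.eq_zero_iff_mem, map_natCast, hq, Nat.card_eq_fintype_card]
    exact Nat.cast_card_eq_zero _
  have hpow : ∀ x : O, x ^ q - x ∈ Q := fun x => by
    rw [← Ideal.Quotient.eq, map_pow, hq, Nat.card_eq_fintype_card, FiniteField.pow_card]
  obtain ⟨g, hg⟩ := IsCyclic.exists_generator (α := (O ⧸ Q)ˣ)
  obtain ⟨u, hu⟩ := Ideal.Quotient.mk_surjective (g : O ⧸ Q)
  have hlt : Q ^ 2 < Q := by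
    simpa using Ideal.pow_right_strictAnti Q hQ0 hQ.ne_top one_lt_two
  obtain ⟨π, hπ, hπ2⟩ := SetLike.exists_of_lt hlt
  obtain ⟨v, hv, hvQ⟩ : ∃ v : O, Ideal.Quotient.mk Q v = g ∧ v ^ q - v ∉ Q ^ 2 := by
    by_cases h : u ^ q - u ∈ Q ^ 2
    · refine ⟨u + π, by simp [hu, Ideal.Quotient.eq_zero_iff_mem.mpr hπ], fun h' => hπ2 ?_⟩
      obtain ⟨k, hk⟩ := Polynomial.powAddExpansion u π q
      have h1 : (q : O) * π ∈ Q ^ 2 := by rw [pow_two]; exact Ideal.mul_mem_mul hqQ hπ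
      have h2 : π ^ 2 ∈ Q ^ 2 := Ideal.pow_mem_pow hπ 2
      have : π = (u ^ q - u) - ((u + π) ^ q - (u + π)) + u ^ (q - 1) * (q * π) + k * π ^ 2 := by
        rw [hk]; ring
      rw [this]
      exact add_mem (add_mem (sub_mem h h') (Ideal.mul_mem_left _ _ h1)) (Ideal.mul_mem_left _ _ h2)
    · exact ⟨u, hu, h⟩
  have hcop : IsCoprime (Q ^ 2) B := IsCoprime.pow_left (Ideal.isCoprime_iff_sup_eq.mpr hB)
  obtain ⟨d, hd, c, hc, hdc⟩ := Ideal.isCoprime_iff_exists.mp hcop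
  have hcv : c * v - v ∈ Q ^ 2 := by
    have : c * v - v = -v * d := by rw [eq_sub_of_add_eq' hdc]; ring
    rw [this]; exact Ideal.mul_mem_left _ _ hd
  have hmk : Ideal.Quotient.mk Q (c * v) = g := by
    rw [← hv, Ideal.Quotient.eq]; exact hlt.le hcv
  refine ⟨c * v, Ideal.mul_mem_right _ _ hc, ?_, ?_, fun h => hvQ ?_⟩
  · rw [← Ideal.Quotient.eq_zero_iff_mem, hmk]; exact g.ne_zero
  · intro x hx
    rw [← Ideal.Quotient.eq_zero_iff_mem] at hx
    obtain ⟨n, hn⟩ := (mem_powers_iff_mem_zpowers.mpr (hg (Units.mk0 _ hx)))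
    refine ⟨n, ?_⟩
    rw [← Ideal.Quotient.eq, map_pow, hmk]
    simpa using (congrArg Units.val hn).symm
  · obtain ⟨t, ht⟩ := sub_dvd_pow_sub_pow (c * v) v q
    have : v ^ q - v = ((c * v) ^ q - c * v) + (c * v - v) - (c * v - v) * t := by
      rw [← ht]; ring
    rw [this]
    exact sub_mem (add_mem h hcv) (Ideal.mul_mem_right _ _ hcv)

theorem exists_mem_conductor_notMem {O : Type*} [CommRing O] [IsDedekindDomain O] [CharZero O]
    [Module.Finite ℤ O] {Q : Ideal O} [hQ : Q.IsMaximal] [Finite (O ⧸ Q)]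
    {p : ℕ} (hp : p ≠ 0) (hpQ : (p : O) ∈ Q) :
    ∃ α : O, ∃ s ∈ conductor ℤ α, s ∉ Q := by
  have hQ0 : Q ≠ ⊥ := by rintro rfl; simp [hp] at hpQ
  have hp0 : Ideal.span {(p : O)} ≠ ⊥ := by simpa using hp
  have hQp : Prime Q := Ideal.prime_of_isPrime hQ0 hQ.isPrime
  have coprime_of_not_dvd {C : Ideal O} (hC : ¬ Q ∣ C) : Q ⊔ C = ⊤ := by
    by_contra h
    exact hC (Ideal.dvd_iff_le.mpr
      ((hQ.eq_of_le h le_sup_left).symm ▸ (le_sup_right : C ≤ Q ⊔ C)))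
  obtain ⟨B, hpB, hQB⟩ := (FiniteMultiplicity.of_prime_left hQp hp0).exists_eq_pow_mul_and_not_dvd
  set e := multiplicity Q (Ideal.span {(p : O)})
  have he : e ≠ 0 := by
    intro h
    rw [h, pow_zero, one_mul] at hpB
    exact hQB (hpB ▸ Ideal.dvd_span_singleton.mpr hpQ)
  obtain ⟨α, hαB, hαQ, hgen, hα2⟩ :=
    Ideal.exists_mem_pow_card_sub_self_notMem_sq hQ0 (coprime_of_not_dvd hQB)
  set q := Nat.card (O ⧸ Q) with hq
  have hq1 : 1 < q := Finite.one_lt_card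
  set ϖ := α ^ q - α with hϖ
  set β := α ^ (q - 1) with hβ
  have hβB : β ∈ B := Ideal.pow_mem_of_mem _ hαB _ (by omega)
  have hϖβ : ϖ = - (α * (1 - β)) := by
    rw [hϖ, hβ, mul_sub, ← pow_succ', Nat.sub_add_cancel hq1.le]; ring
  have hϖQ : ϖ ∈ Q := by
    let _ : Field (O ⧸ Q) := Ideal.Quotient.field Q
    let _ : Fintype (O ⧸ Q) := Fintype.ofFinite _
    rw [hϖ, ← Ideal.Quotient.eq, map_pow, hq, Nat.card_eq_fintype_card, FiniteField.pow_card]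
  have hβQ : 1 - β ∈ Q := by
    rw [hϖβ, neg_mem_iff] at hϖQ
    exact (hQ.isPrime.mem_or_mem hϖQ).resolve_left hαQ
  obtain ⟨C, hC⟩ : Q ∣ Ideal.span {ϖ} := Ideal.dvd_span_singleton.mpr hϖQ
  have hQC : ¬ Q ∣ C := by
    rintro ⟨D, rfl⟩
    refine hα2 (Ideal.dvd_span_singleton.mp ⟨D, ?_⟩)
    rw [hC, pow_two, mul_assoc]
  have key : Q * B ≤ Ideal.span {(p : O)} ⊔ Ideal.span {ϖ} := by
    have hcop : Q ^ (e - 1) ⊔ C = ⊤ := by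
      rw [← Ideal.isCoprime_iff_sup_eq]
      exact (Ideal.isCoprime_iff_sup_eq.mpr (coprime_of_not_dvd hQC)).pow_left
    calc Q * B = Q * (B * (Q ^ (e - 1) ⊔ C)) := by rw [hcop, Ideal.mul_top]
      _ = Q * Q ^ (e - 1) * B ⊔ Q * C * B := by rw [Ideal.mul_sup, Ideal.mul_sup]; congr 1 <;> ring
      _ ≤ _ := by
        rw [← pow_succ', Nat.sub_add_cancel (Nat.one_le_iff_ne_zero.mpr he), ← hpB, ← hC]
        exact sup_le_sup le_rfl Ideal.mul_le_left
  let R := Algebra.adjoin ℤ {α}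
  let m : Ideal R := Q.comap (algebraMap R O)
  let N : Submodule R O := LinearMap.range (Algebra.linearMap R O)
  have hαR : α ∈ R := Algebra.self_mem_adjoin_singleton ℤ α
  have hsmul (r : O) (hr : r ∈ R) (hrQ : r ∈ Q) (x : O) :
      N.mkQ (r * x) ∈ m • (⊤ : Submodule R (O ⧸ N)) := by
    have : N.mkQ (r * x) = (⟨r, hr⟩ : R) • N.mkQ x := by rw [← map_smul]; rfl
    rw [this]
    exact Submodule.smul_mem_smul hrQ trivial
  have : Module.Finite R O := Module.Finite.of_restrictScalars_finite ℤ R O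
  obtain ⟨r, hr, hr0⟩ := Submodule.exists_sub_one_mem_and_smul_eq_zero_of_fg_of_le_smul m
    (⊤ : Submodule R (O ⧸ N)) Module.Finite.fg_top (by
      rintro z -
      obtain ⟨x, rfl⟩ := N.mkQ_surjective z
      obtain ⟨t, ht, hxt⟩ : ∃ t ∈ R, x - t ∈ Q := by
        by_cases hx : x ∈ Q
        · exact ⟨0, zero_mem _, by simpa using hx⟩
        · obtain ⟨n, hn⟩ := hgen x hx
          exact ⟨α ^ n, pow_mem hαR n, hn⟩
      set y := x - t with hy
      obtain ⟨a, b, hab⟩ : ∃ a b, β * y = p * a + ϖ * b := by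
        have := key (Ideal.mul_mem_mul hxt hβB)
        obtain ⟨u, hu, v, hv, huv⟩ := Submodule.mem_sup.mp this
        obtain ⟨a, rfl⟩ := Ideal.mem_span_singleton.mp hu
        obtain ⟨b, rfl⟩ := Ideal.mem_span_singleton.mp hv
        exact ⟨a, b, by rw [mul_comm, huv]⟩
      have hx : x = t + (p * a + ϖ * b + (1 - β) * y) := by rw [← hab, hy]; ring
      have ht0 : N.mkQ t = 0 := by
        simpa using ⟨(⟨t, ht⟩ : R), rfl⟩
      rw [hx, map_add, ht0, zero_add, map_add, map_add]
      have hβR : β ∈ R := pow_mem hαR _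
      exact add_mem (add_mem (hsmul _ (natCast_mem R p) hpQ _)
        (hsmul _ (sub_mem (pow_mem hαR _) hαR) hϖQ _))
        (hsmul _ (sub_mem (one_mem R) hβR) hβQ _))
  refine ⟨α, r, fun b => ?_, fun hrQ => hQ.ne_top ?_⟩
  · have := hr0 (N.mkQ b) trivial
    rw [← map_smul, Submodule.mkQ_apply, Submodule.Quotient.mk_eq_zero] at this
    obtain ⟨c, hc⟩ := this
    have h : (r : O) * b = c := hc.symm
    rw [h]; exact c.2
  · rw [Ideal.eq_top_iff_one]
    have h1 : (r : O) - 1 ∈ Q := hr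
    simpa using sub_mem hrQ h1

namespace NumberField

variable {K : Type*} [Field K] [NumberField K]

theorem adjoin_eq_top_of_mem_conductor {α s : 𝓞 K} (hs : s ∈ conductor ℤ α) (hs0 : s ≠ 0) :
    Algebra.adjoin ℚ {algebraMap (𝓞 K) K α} = ⊤ := by
  set L := Algebra.adjoin ℚ {algebraMap (𝓞 K) K α}
  have hL (y : 𝓞 K) (hy : y ∈ Algebra.adjoin ℤ {α}) : algebraMap (𝓞 K) K y ∈ L := by
    induction hy using Algebra.adjoin_induction with
    | mem x hx => rw [Set.mem_singleton_iff.mp hx]; exact Algebra.self_mem_adjoin_singleton _ _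
    | algebraMap n => simp
    | add x y _ _ hx hy => rw [map_add]; exact add_mem hx hy
    | mul x y _ _ hx hy => rw [map_mul]; exact mul_mem hx hy
  refine eq_top_iff.mpr fun x _ => ?_
  obtain ⟨b, n, hn, hx⟩ := IsFractionRing.div_surjective (A := 𝓞 K) x
  have hm (y : 𝓞 K) : algebraMap (𝓞 K) K y ∈ L := by
    have h1 := hL _ (mem_conductor_iff.mp hs y)
    have h2 := hL _ (mem_conductor_iff.mp hs 1)
    rw [mul_one] at h2
    have h3 := L.inv_mem_of_algebraic (x := ⟨_, h2⟩) (Algebra.IsAlgebraic.isAlgebraic _)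
    have := mul_mem h3 h1
    rwa [map_mul, inv_mul_cancel_left₀ (by simpa using hs0)] at this
  rw [← hx, div_eq_mul_inv]
  exact mul_mem (hm b) (L.inv_mem_of_algebraic (x := ⟨_, hm n⟩) (Algebra.IsAlgebraic.isAlgebraic _))

variable [IsGalois ℚ K]

open Polynomial in
theorem minpoly_map_eq_prod {E F : Type*} [Field E] [Field F] [Algebra E F] [FiniteDimensional E F]
    [IsGalois E F] {a : F} (ha : Algebra.adjoin E {a} = ⊤) :
    (minpoly E a).map (algebraMap E F) = ∏ σ : F ≃ₐ[E] F, (X - C (σ a)) := by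
  have ha_int : IsIntegral E a := Algebra.IsIntegral.isIntegral a
  refine eq_of_monic_of_dvd_of_natDegree_le (monic_prod_of_monic _ _ fun σ _ => monic_X_sub_C _)
    ((minpoly.monic ha_int).map _) ?_ ?_
  · refine Finset.prod_dvd_of_coprime (fun σ _ τ _ hne => ?_) fun σ _ => ?_
    · refine pairwise_coprime_X_sub_C (s := fun σ : F ≃ₐ[E] F => σ a) (fun σ τ h => ?_) hne
      have := AlgHom.ext_of_adjoin_eq_top ha (φ₁ := (σ : F →ₐ[E] F)) (φ₂ := (τ : F →ₐ[E] F))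
        (by simpa using h)
      exact AlgEquiv.ext fun x => DFunLike.congr_fun this x
    · rw [dvd_iff_isRoot, IsRoot, eval_map_algebraMap]
      exact (aeval_algHom_apply σ a (minpoly E a)).trans (by simp)
  · rw [natDegree_prod_of_monic _ _ fun σ _ => monic_X_sub_C _, natDegree_map]
    simp only [natDegree_X_sub_C, Finset.sum_const, smul_eq_mul, mul_one, Finset.card_univ]
    rw [← Nat.card_eq_fintype_card, IsGalois.card_aut_eq_finrank]
    exact minpoly.natDegree_le a

open Polynomial in
theorem aeval_derivative_minpoly_eq_prod [DecidableEq (K ≃ₐ[ℚ] K)] {α : 𝓞 K}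
    (hα : Algebra.adjoin ℚ {algebraMap (𝓞 K) K α} = ⊤) :
    aeval α (derivative (minpoly ℤ α)) =
      ∏ σ ∈ (Finset.univ : Finset (K ≃ₐ[ℚ] K)).erase 1, (α - σ • α) := by
  apply IsFractionRing.injective (𝓞 K) K
  have h := minpoly_map_eq_prod hα
  rw [← Finset.mul_prod_erase _ _ (Finset.mem_univ 1)] at h
  have h2 := congrArg (fun f => (derivative f).eval (algebraMap (𝓞 K) K α)) h
  simp only [derivative_mul, derivative_map, eval_map_algebraMap] at h2
  rw [minpoly.isIntegrallyClosed_eq_field_fractions (R := ℤ) ℚ K (Algebra.IsIntegral.isIntegral α),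
    derivative_map, aeval_map_algebraMap ℚ,
    aeval_algebraMap_apply] at h2
  rw [h2]
  simp [eval_prod, map_prod]
  rfl
end NumberField

theorem Ideal.mem_inertia_pow_iff {O : Type*} [CommRing O] [IsDedekindDomain O] {G : Type*}
    [Group G] [MulSemiringAction G O] {Q : Ideal O} [Q.IsPrime] {α s : O}
    (hs : s ∈ conductor ℤ α) (hsQ : s ∉ Q) (n : ℕ) (σ : G) :
    σ ∈ (Q ^ n).inertia G ↔ α - σ • α ∈ Q ^ n := by
  rw [← neg_sub (σ • α) α, neg_mem_iff]
  refine ⟨fun h => h α, fun h x => ?_⟩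
  have hR (y : O) (hy : y ∈ Algebra.adjoin ℤ {α}) : σ • y - y ∈ Q ^ n := by
    induction hy using Algebra.adjoin_induction with
    | mem x hx => rwa [Set.mem_singleton_iff.mp hx]
    | algebraMap m =>
      have : σ • (algebraMap ℤ O m) = algebraMap ℤ O m :=
        map_intCast (MulSemiringAction.toRingHom G O σ) m
      rw [this, sub_self]; exact zero_mem _
    | add x y _ _ hx hy =>
      rw [smul_add, add_sub_add_comm]; exact add_mem hx hy
    | mul x y _ _ hx hy =>
      have : σ • (x * y) - x * y = σ • x * (σ • y - y) + y * (σ • x - x) := by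
        rw [smul_mul']; ring
      rw [this]; exact add_mem (Ideal.mul_mem_left _ _ hy) (Ideal.mul_mem_left _ _ hx)
  have h1 := hR _ (mem_conductor_iff.mp hs x)
  have h2 := hR s (by simpa using mem_conductor_iff.mp hs 1)
  have : s * (σ • x - x) ∈ Q ^ n := by
    have e : s * (σ • x - x) = (σ • (s * x) - s * x) - (σ • x) * (σ • s - s) := by
      rw [smul_mul']; ring
    rw [e]; exact sub_mem h1 (Ideal.mul_mem_left _ _ h2)
  exact (Ideal.IsPrime.mul_mem_pow Q this).resolve_left hsQ

open scoped Classical in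
theorem Ideal.emultiplicity_span_singleton {O : Type*} [CommRing O] [IsDedekindDomain O]
    {Q : Ideal O} (hQ : Prime Q) {y : O} (hy : y ≠ 0) :
    ∃ N, ∀ n ≥ N, y ∉ Q ^ (n + 1) ∧ emultiplicity Q (Ideal.span {y}) =
      ({i ∈ Finset.range n | y ∈ Q ^ (i + 1)} : Finset ℕ).card := by
  classical
  have hf : FiniteMultiplicity Q (Ideal.span {y}) :=
    FiniteMultiplicity.of_prime_left hQ (by simpa using hy)
  have h (i : ℕ) : y ∈ Q ^ (i + 1) ↔ i < multiplicity Q (Ideal.span {y}) := by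
    rw [← Ideal.dvd_span_singleton, hf.pow_dvd_iff_le_multiplicity, Nat.succ_le_iff]
  refine ⟨multiplicity Q (Ideal.span {y}), fun n hn => ⟨by rw [h]; omega, ?_⟩⟩
  rw [hf.emultiplicity_eq_multiplicity]
  have : ({i ∈ Finset.range n | y ∈ Q ^ (i + 1)} : Finset ℕ) =
      Finset.range (multiplicity Q (Ideal.span {y})) := by
    ext i; simp only [Finset.mem_filter, Finset.mem_range, h]; omega
  rw [this, Finset.card_range]

/-- Hilbert's formula for the exponent of a prime in the different. -/
theorem NumberField.exists_emultiplicity_differentIdeal_eq {K : Type*} [Field K] [NumberField K]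
    [IsGalois ℚ K] {Q : Ideal (𝓞 K)} [hQ : Q.IsMaximal] (hQ0 : Q ≠ ⊥) :
    ∃ N, (∀ i ≥ N, (Q ^ (i + 1)).inertia (K ≃ₐ[ℚ] K) = ⊥) ∧
      emultiplicity Q (differentIdeal ℤ (𝓞 K)) =
        (∑ i ∈ Finset.range N, (Nat.card ((Q ^ (i + 1)).inertia (K ≃ₐ[ℚ] K)) - 1) : ℕ) := by
  classical
  have : Finite (𝓞 K ⧸ Q) := Ideal.finiteQuotientOfFreeOfNeBot Q hQ0
  have hQp : Prime Q := Ideal.prime_of_isPrime hQ0 hQ.isPrime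
  obtain ⟨α, s, hs, hsQ⟩ := exists_mem_conductor_notMem (Q := Q) (p := Ideal.absNorm Q)
    (by simpa [Ideal.absNorm_eq_zero_iff] using hQ0) (Ideal.absNorm_mem Q)
  have hs0 : s ≠ 0 := by rintro rfl; exact hsQ (zero_mem _)
  have htop := adjoin_eq_top_of_mem_conductor hs hs0
  have hne (σ : K ≃ₐ[ℚ] K) (hσ : σ ≠ 1) : α - σ • α ≠ 0 := by
    refine fun h => hσ (AlgEquiv.ext fun x => ?_)
    have h1 : algebraMap (𝓞 K) K α = σ (algebraMap (𝓞 K) K α) :=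
      congrArg (algebraMap (𝓞 K) K) (sub_eq_zero.mp h)
    have := AlgHom.ext_of_adjoin_eq_top htop (φ₁ := (σ : K →ₐ[ℚ] K)) (φ₂ := AlgHom.id ℚ K)
      (by simpa using h1.symm)
    exact DFunLike.congr_fun this x
  choose! N hN using fun σ hσ => Ideal.emultiplicity_span_singleton hQp (hne σ hσ)
  set M := (Finset.univ : Finset (K ≃ₐ[ℚ] K)).sup N
  have hM (σ : K ≃ₐ[ℚ] K) : N σ ≤ M := Finset.le_sup (Finset.mem_univ σ)
  refine ⟨M, fun i hi => (Subgroup.eq_bot_iff_forall _).mpr fun σ hσ => ?_, ?_⟩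
  · by_contra h1
    rw [Ideal.mem_inertia_pow_iff hs hsQ] at hσ
    exact (hN σ h1 i ((hM σ).trans hi)).1 hσ
  · have hmul := conductor_mul_differentIdeal ℤ ℚ K α htop
    have hc : emultiplicity Q (conductor ℤ α) = 0 := by
      rw [emultiplicity_eq_zero, Ideal.dvd_iff_le]
      exact fun h => hsQ (h hs)
    rw [← zero_add (emultiplicity Q (differentIdeal ℤ (𝓞 K))), ← hc, ← emultiplicity_mul hQp, hmul,
      aeval_derivative_minpoly_eq_prod htop, ← Ideal.prod_span_singleton,
      Finset.emultiplicity_prod hQp,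
      Finset.sum_congr rfl fun σ hσ => (hN σ (Finset.ne_of_mem_erase hσ) M (hM σ)).2,
      ← Nat.cast_sum]
    congr 1
    simp only [Finset.card_filter]
    rw [Finset.sum_comm]
    refine Finset.sum_congr rfl fun i _ => ?_
    rw [← Finset.card_filter, Nat.card_eq_fintype_card, Fintype.card_subtype]
    rw [← Finset.card_erase_of_mem (a := 1) (by simp)]
    congr 1
    ext σ
    simp [Ideal.mem_inertia_pow_iff hs hsQ]

open Pointwise in
theorem Ideal.card_inertia_smul {O G : Type*} [CommRing O] [Group G] [MulSemiringAction G O]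
    (σ : G) (I : Ideal O) : Nat.card ((σ • I).inertia G) = Nat.card (I.inertia G) := by
  refine Nat.card_congr ((MulAut.conj σ⁻¹).toEquiv.subtypeEquiv fun τ => ?_)
  simp only [AddSubgroup.mem_inertia, Submodule.mem_toAddSubgroup,
    Ideal.mem_pointwise_smul_iff_inv_smul_mem, smul_sub, smul_smul]
  refine ⟨fun h x => ?_, fun h x => ?_⟩
  · simpa [smul_smul, mul_assoc] using h (σ • x)
  · simpa [smul_smul, mul_assoc] using h (σ⁻¹ • x)

namespace NumberField

variable {K : Type*} [Field K] [NumberField K] [IsGalois ℚ K]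

theorem emultiplicity_differentIdeal_eq_finsum {Q : Ideal (𝓞 K)} [hQ : Q.IsMaximal] (hQ0 : Q ≠ ⊥) :
    emultiplicity Q (differentIdeal ℤ (𝓞 K)) =
      (∑ᶠ i : ℕ, (Nat.card ((Q ^ (i + 1)).inertia (K ≃ₐ[ℚ] K)) - 1) : ℕ) := by
  obtain ⟨N, hN, h⟩ := exists_emultiplicity_differentIdeal_eq hQ0
  rw [h, finsum_eq_sum_of_support_subset]
  intro i hi
  by_contra hiN
  rw [Finset.mem_coe, Finset.mem_range, not_lt] at hiN
  rw [Function.mem_support, hN i hiN, Subgroup.card_bot] at hi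
  exact hi rfl

open Pointwise in
theorem emultiplicity_differentIdeal_eq_of_liesOver (p : Ideal ℤ) {P Q : Ideal (𝓞 K)}
    [hP : P.IsMaximal] [P.LiesOver p] [hQ : Q.IsMaximal] [Q.LiesOver p] (hP0 : P ≠ ⊥) (hQ0 : Q ≠ ⊥) :
    emultiplicity P (differentIdeal ℤ (𝓞 K)) = emultiplicity Q (differentIdeal ℤ (𝓞 K)) := by
  obtain ⟨σ, rfl⟩ := Ideal.exists_smul_eq_of_isGaloisGroup p P Q (K ≃ₐ[ℚ] K)
  rw [emultiplicity_differentIdeal_eq_finsum hP0, emultiplicity_differentIdeal_eq_finsum hQ0]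
  simp_rw [← smul_pow', Ideal.card_inertia_smul]

/-- The discriminant of a Galois number field in terms of a chosen prime above each rational
prime. -/
theorem exists_finset_log_abs_discr_eq_sum {Q : {p : ℕ // p.Prime} → Ideal (𝓞 K)}
    (hQ : ∀ p, (Q p).IsPrime) (hQp : ∀ p, (Q p).LiesOver (Ideal.span {((p : ℕ) : ℤ)}))
    {v : {p : ℕ // p.Prime} → ℕ} (hv : ∀ p, emultiplicity (Q p) (differentIdeal ℤ (𝓞 K)) = v p) :
    ∃ T : Finset {p : ℕ // p.Prime}, (∀ p ∉ T, v p = 0) ∧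
      Real.log |(discr K : ℝ)| = ∑ p ∈ T,
        (((Ideal.span {((p : ℕ) : ℤ)}).primesOver (𝓞 K)).ncard * (Q p).inertiaDeg ℤ * v p : ℕ) *
          Real.log (p : ℕ) := by
  classical
  set D := differentIdeal ℤ (𝓞 K) with hD
  have hD0 : D ≠ ⊥ := differentIdeal_ne_bot
  have hp0 (p : {p : ℕ // p.Prime}) : Ideal.span {((p : ℕ) : ℤ)} ≠ ⊥ := by
    simpa using p.2.ne_zero
  have hpmax (p : {p : ℕ // p.Prime}) : (Ideal.span {((p : ℕ) : ℤ)}).IsMaximal :=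
    have : Fact (p : ℕ).Prime := ⟨p.2⟩
    Int.ideal_span_isMaximal_of_prime p
  have hne (p : {p : ℕ // p.Prime}) (P : Ideal (𝓞 K)) [P.LiesOver (Ideal.span {((p : ℕ) : ℤ)})] :
      P ≠ ⊥ := Ideal.ne_bot_of_liesOver_of_ne_bot (hp0 p) P
  have hcount (P : Ideal (𝓞 K)) (hP : P.IsPrime) (p : {p : ℕ // p.Prime})
      (hPp : P.LiesOver (Ideal.span {((p : ℕ) : ℤ)})) :
      (UniqueFactorizationMonoid.normalizedFactors D).count P = v p := by
    have hP0 := hne p P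
    have hQ0 := hne p (Q p)
    have := hP.isMaximal hP0
    have := (hQ p).isMaximal hQ0
    have h := hv p
    rw [← emultiplicity_differentIdeal_eq_of_liesOver (Ideal.span {((p : ℕ) : ℤ)}) hP0 hQ0,
      UniqueFactorizationMonoid.emultiplicity_eq_count_normalizedFactors
        (Ideal.prime_of_isPrime hP0 hP).irreducible hD0, normalize_eq] at h
    exact_mod_cast h
  have hnorm (P : Ideal (𝓞 K)) (hP : P.IsPrime) (p : {p : ℕ // p.Prime})
      (hPp : P.LiesOver (Ideal.span {((p : ℕ) : ℤ)})) :
      Ideal.absNorm P = (p : ℕ) ^ (Q p).inertiaDeg ℤ := by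
    have := hQ p
    have := hQp p
    rw [Ideal.inertiaDeg_eq_of_isGaloisGroup (Ideal.span {((p : ℕ) : ℤ)}) (Q p) P (K ≃ₐ[ℚ] K)]
    have := Ideal.natAbs_pow_inertiaDeg ((p : ℕ) : ℤ) P
    simpa using this.symm
  set S := (UniqueFactorizationMonoid.normalizedFactors D).toFinset with hS
  have hSprime (P : Ideal (𝓞 K)) (hP : P ∈ S) : P.IsPrime := by
    rw [hS, Multiset.mem_toFinset] at hP
    exact Ideal.isPrime_of_prime (UniqueFactorizationMonoid.prime_of_normalized_factor P hP)
  have hex (P : Ideal (𝓞 K)) (hP : P ∈ S) :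
      ∃ p : {p : ℕ // p.Prime}, P.LiesOver (Ideal.span {((p : ℕ) : ℤ)}) := by
    have := hSprime P hP
    have : NeZero P := ⟨by
      rw [hS, Multiset.mem_toFinset] at hP
      exact (UniqueFactorizationMonoid.prime_of_normalized_factor P hP).ne_zero⟩
    exact ⟨⟨_, Nat.absNorm_under_prime P⟩, Int.liesOver_span_absNorm P⟩
  have : Nonempty {p : ℕ // p.Prime} := ⟨⟨2, Nat.prime_two⟩⟩
  choose! pr hpr using hex
  have hmem (P : Ideal (𝓞 K)) (hP : P.IsPrime) (p : {p : ℕ // p.Prime})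
      (hPp : P.LiesOver (Ideal.span {((p : ℕ) : ℤ)})) : P ∈ S ↔ v p ≠ 0 := by
    rw [hS, Multiset.mem_toFinset, ← Multiset.count_ne_zero, hcount P hP p hPp]
  have hinj (P : Ideal (𝓞 K)) (p q : {p : ℕ // p.Prime})
      (h1 : P.LiesOver (Ideal.span {((p : ℕ) : ℤ)})) (h2 : P.LiesOver (Ideal.span {((q : ℕ) : ℤ)})) :
      p = q := by
    have := h1.over.trans h2.over.symm
    rw [Ideal.span_singleton_eq_span_singleton, Int.associated_iff_natAbs] at this
    exact Subtype.ext (by simpa using this)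
  set T := S.image pr with hT
  refine ⟨T, fun p hp => ?_, ?_⟩
  · by_contra h
    rw [← ne_eq, ← hmem (Q p) (hQ p) p (hQp p)] at h
    exact hp (Finset.mem_image.mpr ⟨Q p, h, hinj (Q p) _ _ (hpr _ h) (hQp p)⟩)
  · have habs : |(discr K : ℝ)| = (Ideal.absNorm D : ℝ) := by
      rw [hD, absNorm_differentIdeal K (𝓞 K), Nat.cast_natAbs, Int.cast_abs]
    have hlog : Real.log (Ideal.absNorm D : ℝ) =
        ∑ P ∈ S, (v (pr P) * ((Q (pr P)).inertiaDeg ℤ * Real.log (pr P : ℕ))) := by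
      have h1 : Ideal.absNorm D = ∏ P ∈ S, Ideal.absNorm P ^
          (UniqueFactorizationMonoid.normalizedFactors D).count P := by
        conv_lhs => rw [← normalize_eq D, ← UniqueFactorizationMonoid.prod_normalizedFactors_eq hD0,
          map_multiset_prod, Finset.prod_multiset_map_count]
      rw [h1, Nat.cast_prod, Real.log_prod]
      · refine Finset.sum_congr rfl fun P hP => ?_
        rw [hcount P (hSprime P hP) _ (hpr P hP), hnorm P (hSprime P hP) _ (hpr P hP)]
        simp
      · intro P hP
        rw [hnorm P (hSprime P hP) _ (hpr P hP)]
        exact_mod_cast pow_ne_zero _ (pow_ne_zero _ (pr P).2.ne_zero)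
    rw [habs, hlog, ← Finset.sum_fiberwise_of_maps_to (t := T) (g := pr)
      (fun P hP => Finset.mem_image_of_mem pr hP)]
    refine Finset.sum_congr rfl fun p hp => ?_
    rw [Finset.sum_congr rfl (g := fun _ => (v p * ((Q p).inertiaDeg ℤ * Real.log (p : ℕ)) : ℝ))
      (fun P hP => by rw [(Finset.mem_filter.mp hP).2]), Finset.sum_const]
    have hfib : ((Ideal.span {((p : ℕ) : ℤ)}).primesOver (𝓞 K)) =
        (({P ∈ S | pr P = p} : Finset _) : Set (Ideal (𝓞 K))) := by
      obtain ⟨P₀, hP₀, rfl⟩ := Finset.mem_image.mp hp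
      have hv0 := (hmem P₀ (hSprime P₀ hP₀) _ (hpr P₀ hP₀)).mp hP₀
      ext P
      simp only [Finset.coe_filter, Set.mem_ofPred_eq]
      constructor
      · rintro ⟨h1, h2⟩
        have hPS := (hmem P h1 _ h2).mpr hv0
        exact ⟨hPS, hinj P _ _ (hpr P hPS) h2⟩
      · rintro ⟨h1, h2⟩
        exact ⟨hSprime P h1, h2 ▸ hpr P h1⟩
    rw [hfib, Set.ncard_coe_finset, nsmul_eq_mul]
    push_cast
    ring

end NumberField

theorem FDRep.finrank_subInvariants_bot {G : Type} [Group G] (W : FDRep ℂ G) :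
    Module.finrank ℂ (W.subInvariants ⊥) = Module.finrank ℂ W := by
  have : W.subInvariants ⊥ = ⊤ := by
    refine eq_top_iff.mpr fun v _ => ?_
    rintro ⟨g, hg⟩
    obtain rfl := Subgroup.mem_bot.mp hg
    simp
  rw [this, finrank_top]

theorem FDRep.sum_finrank_mul_card_div_mul {G : Type} [Group G] [Finite G] {ι : Type} [Fintype ι]
    {V : ι → FDRep ℂ G} (hirr : ∀ j, Simple (V j))
    (hinj : ∀ j j' : ι, Nonempty (V j ≅ V j') → j = j')
    (hcomplete : ∀ W : FDRep ℂ G, Simple W → ∃ j, Nonempty (W ≅ V j)) (H : Subgroup G) :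
    ∑ j, (Module.finrank ℂ (V j) : ℝ) * (Nat.card H * ((Module.finrank ℂ (V j) : ℝ) -
      (Module.finrank ℂ ((V j).subInvariants H) : ℝ))) = Nat.card G * (Nat.card H - 1 : ℕ) := by
  have hH := FDRep.sum_finrank_mul_finrank_subInvariants hirr hinj hcomplete H
  have hbot := FDRep.sum_finrank_mul_finrank_subInvariants hirr hinj hcomplete ⊥
  simp_rw [FDRep.finrank_subInvariants_bot, Subgroup.index_bot] at hbot
  have h : ∀ j, (Module.finrank ℂ (V j) : ℝ) * (Nat.card H * ((Module.finrank ℂ (V j) : ℝ) -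
      (Module.finrank ℂ ((V j).subInvariants H) : ℝ))) =
      Nat.card H * ((Module.finrank ℂ (V j) * Module.finrank ℂ (V j) : ℕ) : ℝ) -
      Nat.card H * ((Module.finrank ℂ (V j) *
        Module.finrank ℂ ((V j).subInvariants H) : ℕ) : ℝ) := fun j => by
    push_cast; ring
  rw [Finset.sum_congr rfl fun j _ => h j, Finset.sum_sub_distrib, ← Finset.mul_sum,
    ← Finset.mul_sum, ← Nat.cast_sum, ← Nat.cast_sum, hH, hbot, ← Nat.cast_mul (Nat.card H) H.index,
    H.card_mul_index, Nat.cast_sub Nat.card_pos]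
  push_cast
  ring

/-- **The conductor–discriminant formula** for a finite Galois extension `K/ℚ` with group
`G`: `log|Δ_K| = ∑_{χ ∈ Irr(G)} χ(1)·log f(K/ℚ,χ)`, where `Δ_K` is the absolute
discriminant and `f(K/ℚ,χ)` is the norm of the Artin conductor of `χ`. Here `Irr(G)` is
realized as a complete family `(V j)` of pairwise non-isomorphic irreducible complex
representations (`χ_j(1) = dim V j`), and the Artin conductor is expressed through its
definition: `log f(χ) = ∑_p a_p(χ) log p` with local exponent
`a_p(χ) = ∑_{i ≥ 0} (|G_i|/|G_0|)·(χ(1) − dim V^{G_i})`, where `G_i` is the `i`-th lower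
ramification group at a chosen prime `Q p` of `𝓞 K` above `p`, characterized by
`σ ∈ G_i ↔ ∀ x ∈ 𝓞 K, σx − x ∈ (Q p)^{i+1}`. -/
theorem conductor_discriminant_formula
    (K : Type) [Field K] [NumberField K] [IsGalois ℚ K]
    (ι : Type) [Fintype ι] (V : ι → FDRep ℂ (K ≃ₐ[ℚ] K))
    (hirr : ∀ j, Simple (V j))
    (hinj : ∀ j j' : ι, Nonempty (V j ≅ V j') → j = j')
    (hcomplete : ∀ W : FDRep ℂ (K ≃ₐ[ℚ] K), Simple W → ∃ j, Nonempty (W ≅ V j))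
    -- a choice of a prime of `K` above each rational prime `p`
    (Q : {p : ℕ // p.Prime} → Ideal (𝓞 K))
    (hQprime : ∀ p, (Q p).IsPrime)
    (hQover : ∀ p, Ideal.comap (algebraMap ℤ (𝓞 K)) (Q p) = Ideal.span {((p : ℕ) : ℤ)})
    -- the lower ramification groups at `Q p`
    (Gi : {p : ℕ // p.Prime} → ℕ → Subgroup (K ≃ₐ[ℚ] K))
    (hGi : ∀ p (i : ℕ) (σ : K ≃ₐ[ℚ] K), σ ∈ Gi p i ↔
      ∀ x : 𝓞 K, galRestrict ℤ ℚ K (𝓞 K) σ x - x ∈ (Q p) ^ (i + 1)) :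
    Real.log |(NumberField.discr K : ℝ)| =
      ∑ j, (Module.finrank ℂ (V j) : ℝ) *
        ∑' p : {p : ℕ // p.Prime},
          (∑' i : ℕ, (Nat.card (Gi p i) : ℝ) / (Nat.card (Gi p 0) : ℝ) *
              ((Module.finrank ℂ (V j) : ℝ) -
                (Module.finrank ℂ ((V j).subInvariants (Gi p i)) : ℝ))) *
            Real.log ((p : ℕ) : ℝ) := by
  classical
  have hQp p : (Q p).LiesOver (Ideal.span {((p : ℕ) : ℤ)}) := ⟨(hQover p).symm⟩
  have hQ0 p : Q p ≠ ⊥ :=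
    Ideal.ne_bot_of_liesOver_of_ne_bot (p := Ideal.span {((p : ℕ) : ℤ)})
      (by simpa using p.2.ne_zero) (Q p)
  have hGi_eq p i : Gi p i = (Q p ^ (i + 1)).inertia (K ≃ₐ[ℚ] K) := by
    ext σ
    rw [hGi]
    refine forall_congr' fun x => ?_
    have : galRestrict ℤ ℚ K (𝓞 K) σ x = σ • x :=
      RingOfIntegers.ext (algebraMap_galRestrict_apply ℤ σ x)
    rw [this]
    rfl
  have hmax p : (Q p).IsMaximal := (hQprime p).isMaximal (hQ0 p)
  choose N hN hv using fun p => exists_emultiplicity_differentIdeal_eq (hQ0 p)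
  simp_rw [← hGi_eq] at hN hv
  obtain ⟨T, hT, hdiscr⟩ := exists_finset_log_abs_discr_eq_sum hQprime hQp hv
  have hcard (p : {p : ℕ // p.Prime}) :
      (((Ideal.span {((p : ℕ) : ℤ)}).primesOver (𝓞 K)).ncard * (Q p).inertiaDeg ℤ : ℝ) =
        Nat.card (K ≃ₐ[ℚ] K) / Nat.card (Gi p 0) := by
    have hpr : (Ideal.span {((p : ℕ) : ℤ)}).IsPrime :=
      (Ideal.span_singleton_prime (by simpa using p.2.ne_zero)).mpr (Nat.prime_iff_prime_int.mp p.2)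
    have h := Ideal.ncard_primesOver_mul_card_inertia_mul_finrank (G := K ≃ₐ[ℚ] K)
      (Ideal.span {((p : ℕ) : ℤ)}) (Q p)
    rw [eq_div_iff (by exact_mod_cast Nat.card_pos.ne'), ← h, hGi_eq, zero_add, pow_one]
    push_cast
    ring
  have hterm j p i (h : Gi p i = ⊥) : (Nat.card (Gi p i) : ℝ) / (Nat.card (Gi p 0) : ℝ) *
      ((Module.finrank ℂ (V j) : ℝ) -
        (Module.finrank ℂ ((V j).subInvariants (Gi p i)) : ℝ)) = 0 := by
    rw [h, FDRep.finrank_subInvariants_bot, sub_self, mul_zero]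
  have htsum_i j p : (∑' i : ℕ, (Nat.card (Gi p i) : ℝ) / (Nat.card (Gi p 0) : ℝ) *
      ((Module.finrank ℂ (V j) : ℝ) -
        (Module.finrank ℂ ((V j).subInvariants (Gi p i)) : ℝ))) =
      ∑ i ∈ Finset.range (N p), (Nat.card (Gi p i) : ℝ) / (Nat.card (Gi p 0) : ℝ) *
      ((Module.finrank ℂ (V j) : ℝ) -
        (Module.finrank ℂ ((V j).subInvariants (Gi p i)) : ℝ)) :=
    tsum_eq_sum fun i hi => hterm j p i (hN p i (by simpa using hi))
  have htriv p (hp : p ∉ T) i (hi : i ∈ Finset.range (N p)) : Gi p i = ⊥ := by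
    have := Finset.sum_eq_zero_iff.mp (hT p hp) i hi
    rw [← Subgroup.card_eq_one]
    have hpos : 0 < Nat.card (Gi p i) := Nat.card_pos
    omega
  simp_rw [htsum_i]
  have htsum_p j := tsum_eq_sum (L := .unconditional _) (s := T) (f := fun p : {p : ℕ // p.Prime} =>
    (∑ i ∈ Finset.range (N p), (Nat.card (Gi p i) : ℝ) / (Nat.card (Gi p 0) : ℝ) *
      ((Module.finrank ℂ (V j) : ℝ) -
        (Module.finrank ℂ ((V j).subInvariants (Gi p i)) : ℝ))) * Real.log ((p : ℕ) : ℝ))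
    fun p hp => by
      rw [Finset.sum_eq_zero fun i hi => hterm j p i (htriv p hp i hi), zero_mul]
  simp_rw [htsum_p, Finset.mul_sum]
  rw [hdiscr, Finset.sum_comm]
  refine Finset.sum_congr rfl fun p _ => ?_
  simp_rw [← mul_assoc]
  rw [← Finset.sum_mul]
  congr 1
  rw [Nat.cast_mul, Nat.cast_mul, hcard, Nat.cast_sum, Finset.mul_sum]
  simp_rw [Finset.mul_sum]
  rw [Finset.sum_comm]
  refine Finset.sum_congr rfl fun i _ => ?_
  rw [div_mul_eq_mul_div, ← FDRep.sum_finrank_mul_card_div_mul hirr hinj hcomplete (Gi p i),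
    Finset.sum_div]
  refine Finset.sum_congr rfl fun j _ => ?_
  ring
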